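/- Let Z and E be real numbers. For each natural number l define q₀^l(w) := 2/((w + l − 2)(w − l − 3)), q₁^l(w) := −4Z/((w + l − 3)(w + l − 2)(w − l − 3)(w − l − 4)), and q₂^l(w) := (8Z²/((w + l − 3)(w − l − 4)) − 4E)·1/((w + l − 4)(w + l − 2)(w − l − 3)(w − l − 5)). Then wherever all terms are defined: (i) q₂^l(w) = Z²·(1/g_l(w−4))·(1/g_l(w−3))·(1/g_l(w−2)) − E·(1/g_l(w−4))·(1/g_l(w−2)); and (ii) the second-order recursion relation for the parametrix holds: q₂^l(w + 2)·g_l(w) + Z·q₁^l(w + 1) + E·q₀^l(w) = 0. -/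

import Mathlib

/-- The action of the principal conormal symbol of the hydrogen Hamiltonian on the
`l`-th spherical-harmonic sector. -/
noncomputable def g (l : ℕ) (w : ℂ) : ℂ :=
  (1 / 2) * (w ^ 2 - w - (l : ℂ) * ((l : ℂ) + 1))

/-- The `l`-th sector of the Taylor coefficient `h₀^{(−1)}(w)` of the parametrix symbol. -/
noncomputable def q0 (l : ℕ) (w : ℂ) : ℂ :=
  2 / ((w + (l : ℂ) - 2) * (w - (l : ℂ) - 3))

/-- The `l`-th sector of the Taylor coefficient `h₁^{(−1)}(w)` of the parametrix symbol,
for nuclear charge `Z`. -/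
noncomputable def q1 (Z : ℝ) (l : ℕ) (w : ℂ) : ℂ :=
  -4 * (Z : ℂ) / ((w + (l : ℂ) - 3) * (w + (l : ℂ) - 2) * (w - (l : ℂ) - 3) * (w - (l : ℂ) - 4))

/-- The `l`-th sector of the Taylor coefficient `h₂^{(−1)}(w)` of the parametrix symbol,
for nuclear charge `Z` and eigenvalue `E`. -/
noncomputable def q2 (Z E : ℝ) (l : ℕ) (w : ℂ) : ℂ :=
  (8 * (Z : ℂ) ^ 2 / ((w + (l : ℂ) - 3) * (w - (l : ℂ) - 4)) - 4 * (E : ℂ)) *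
    (1 / ((w + (l : ℂ) - 4) * (w + (l : ℂ) - 2) * (w - (l : ℂ) - 3) * (w - (l : ℂ) - 5)))

theorem g_eq_mul (l : ℕ) (w : ℂ) : g l w = (1 / 2) * ((w + l) * (w - l - 1)) := by
  unfold g
  ring

/-- Wherever all terms are defined: (i)
`q₂^l(w) = Z²·(1/g_l(w−4))·(1/g_l(w−3))·(1/g_l(w−2)) − E·(1/g_l(w−4))·(1/g_l(w−2))`, and
(ii) the second-order recursion relation
`q₂^l(w+2)·g_l(w) + Z·q₁^l(w+1) + E·q₀^l(w) = 0` for the parametrix holds. -/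
theorem parametrix_recursion_order_two (Z E : ℝ) (l : ℕ) :
    (∀ w : ℂ, w + (l : ℂ) - 4 ≠ 0 → w + (l : ℂ) - 3 ≠ 0 → w + (l : ℂ) - 2 ≠ 0 →
      w - (l : ℂ) - 3 ≠ 0 → w - (l : ℂ) - 4 ≠ 0 → w - (l : ℂ) - 5 ≠ 0 →
      q2 Z E l w = (Z : ℂ) ^ 2 * (1 / g l (w - 4)) * (1 / g l (w - 3)) * (1 / g l (w - 2))
        - (E : ℂ) * (1 / g l (w - 4)) * (1 / g l (w - 2))) ∧
    (∀ w : ℂ, w + (l : ℂ) ≠ 0 → w + (l : ℂ) - 1 ≠ 0 → w + (l : ℂ) - 2 ≠ 0 →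
      w - (l : ℂ) - 1 ≠ 0 → w - (l : ℂ) - 2 ≠ 0 → w - (l : ℂ) - 3 ≠ 0 →
      q2 Z E l (w + 2) * g l w + (Z : ℂ) * q1 Z l (w + 1) + (E : ℂ) * q0 l w = 0) := by
  constructor
  · intro w h1 h2 h3 h4 h5 h6
    have e4 : g l (w - 4) = (1 / 2) * ((w + l - 4) * (w - l - 5)) := by
      rw [g_eq_mul]; ring
    have e3 : g l (w - 3) = (1 / 2) * ((w + l - 3) * (w - l - 4)) := by
      rw [g_eq_mul]; ring
    have e2 : g l (w - 2) = (1 / 2) * ((w + l - 2) * (w - l - 3)) := by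
      rw [g_eq_mul]; ring
    rw [e4, e3, e2, q2]
    field_simp
    ring
  · intro w h1 h2 h3 h4 h5 h6
    rw [g_eq_mul, q2, q1, q0]
    rw [show w + 2 + (l : ℂ) - 3 = w + l - 1 by ring, show w + 2 - (l : ℂ) - 4 = w - l - 2 by ring,
      show w + 2 + (l : ℂ) - 4 = w + l - 2 by ring, show w + 2 + (l : ℂ) - 2 = w + l by ring,
      show w + 2 - (l : ℂ) - 3 = w - l - 1 by ring, show w + 2 - (l : ℂ) - 5 = w - l - 3 by ring,
      show w + 1 + (l : ℂ) - 3 = w + l - 2 by ring, show w + 1 + (l : ℂ) - 2 = w + l - 1 by ring,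
      show w + 1 - (l : ℂ) - 3 = w - l - 2 by ring, show w + 1 - (l : ℂ) - 4 = w - l - 3 by ring]
    field_simp
    ring
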